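/- Let (X,d) be a metric space with marked point p. If X is midpoint convex at p and liminf_{w,x,y,z→p} A₁(w,x,y,z) ≥ 0, then every separable tangent space Ω_{p,r̃}^X is a geodesic metric space whose metric ρ satisfies the quadrilateral inequality ρ²(α,γ)+ρ²(β,η) ≤ ρ²(α,β)+ρ²(β,γ)+ρ²(γ,η)+ρ²(η,α) for all α,β,γ,η (i.e., Ω_{p,r̃}^X is a CAT(0) space by the Berg–Nikolaev characterization). -/

import Mathlib

open Filter Topology

universe u

section Defs

variable {X : Type u} [MetricSpace X]

/-- A normalizing sequence is a sequence of positive reals tending to zero. -/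
def IsNormalizingSeq (r : ℕ → ℝ) : Prop :=
  (∀ n, 0 < r n) ∧ Tendsto r atTop (𝓝 0)

/-- Two sequences of points of `X` are mutually stable w.r.t. `r` if
`d(x_n, y_n)/r_n` converges to a finite limit. -/
def MutuallyStable (r : ℕ → ℝ) (x y : ℕ → X) : Prop :=
  ∃ L : ℝ, Tendsto (fun n => dist (x n) (y n) / r n) atTop (𝓝 L)

/-- A family of sequences is self-stable if any two members are mutually stable. -/
def SelfStable (r : ℕ → ℝ) (F : Set (ℕ → X)) : Prop :=
  ∀ x ∈ F, ∀ y ∈ F, MutuallyStable r x y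

/-- A maximal self-stable family containing the constant sequence `p`. -/
def MaximalSelfStable (p : X) (r : ℕ → ℝ) (F : Set (ℕ → X)) : Prop :=
  SelfStable r F ∧ (fun _ => p) ∈ F ∧
    ∀ G : Set (ℕ → X), SelfStable r G → F ⊆ G → G = F

/-- `(Ω, π)` is (a realization of) the pretangent space of `X` at `p`
with respect to the normalizing sequence `r` and the maximal self-stable family
`F`; the map `π` is the metric identification projection, so that the distance
in `Ω` between `π x` and `π y` is `lim_n d(x_n,y_n)/r_n`. -/
def IsPretangentSpace (p : X) (r : ℕ → ℝ) (F : Set (ℕ → X))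
    {Ω : Type u} [MetricSpace Ω] (π : (ℕ → X) → Ω) : Prop :=
  IsNormalizingSeq r ∧ MaximalSelfStable p r F ∧
    (∀ ω : Ω, ∃ x ∈ F, π x = ω) ∧
    ∀ x ∈ F, ∀ y ∈ F,
      Tendsto (fun n => dist (x n) (y n) / r n) atTop (𝓝 (dist (π x) (π y)))

/-- The pretangent space determined by the maximal self-stable family `F` is
tangent: for every strictly increasing sequence `φ` of naturals and every
maximal self-stable family `F'` w.r.t. `r ∘ φ` containing all `x ∘ φ` with
`x ∈ F`, the canonical isometric embedding `em'` is bijective (being always an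
isometric embedding it suffices that it be surjective, as stated here). -/
def IsTangentFamily (p : X) (r : ℕ → ℝ) (F : Set (ℕ → X)) : Prop :=
  ∀ φ : ℕ → ℕ, StrictMono φ →
    ∀ F' : Set (ℕ → X), MaximalSelfStable p (r ∘ φ) F' →
      (∀ x ∈ F, x ∘ φ ∈ F') →
      ∀ y ∈ F', ∃ x ∈ F,
        Tendsto (fun k => dist (x (φ k)) (y k) / r (φ k)) atTop (𝓝 0)

/-- `δ_p(w,x,y,z) = max_i d(x_i, p)`. -/
noncomputable def delta4 (p w x y z : X) : ℝ :=
  max (dist w p) (max (dist x p) (max (dist y p) (dist z p)))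

/-- `δ_p(x,y,z) = max_i d(x_i, p)`. -/
noncomputable def delta3 (p x y z : X) : ℝ :=
  max (dist x p) (max (dist y p) (dist z p))

open Classical in
/-- The function `A₁` of Berg–Nikolaev type. -/
noncomputable def A1 (p w x y z : X) : ℝ :=
  if w = p ∧ x = p ∧ y = p ∧ z = p then 0
  else (dist w x ^ 2 + dist x y ^ 2 + dist y z ^ 2 + dist z w ^ 2
          - dist w y ^ 2 - dist x z ^ 2) / delta4 p w x y z ^ 2

open Classical in
/-- The function `A₂` of Lebedeva–Petrunin type. -/
noncomputable def A2 (p w x y z : X) : ℝ :=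
  if w = p ∧ x = p ∧ y = p ∧ z = p then 0
  else (dist w x ^ 2 + dist w y ^ 2 + dist w z ^ 2
          - (dist x y ^ 2 + dist y z ^ 2 + dist z x ^ 2) / 3) / delta4 p w x y z ^ 2

open Classical in
/-- The function `A₃` of Ptolemy type. -/
noncomputable def A3 (p w x y z : X) : ℝ :=
  if w = p ∧ x = p ∧ y = p ∧ z = p then 0
  else (dist x w * dist y z + dist x z * dist y w - dist x y * dist w z)
          / delta4 p w x y z ^ 2

open Classical in
/-- The quotient `|d(w,z) - d(x,y)/2| / δ_p(x,y)`, valued in `EReal`, with the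
conventions: `0` if `x = y = p` and `z = p`, and `+∞` if `x = y = p` but `z ≠ p`. -/
noncomputable def midQuot (p w x y z : X) : EReal :=
  if x = p ∧ y = p then (if z = p then (0 : EReal) else ⊤)
  else ((|dist w z - dist x y / 2| / max (dist x p) (dist y p) : ℝ) : EReal)

/-- `z` is an infinitesimal midpoint of the sequences `x` and `y`. -/
def IsInfinitesimalMidpoint (p : X) (x y z : ℕ → X) : Prop :=
  Tendsto (fun n => midQuot p (x n) (x n) (y n) (z n)) atTop (𝓝 (0 : EReal)) ∧
    Tendsto (fun n => midQuot p (y n) (x n) (y n) (z n)) atTop (𝓝 (0 : EReal))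

/-- `X` is midpoint convex at the marked point `p`. -/
def MidpointConvexAt (p : X) : Prop :=
  ∀ x y : ℕ → X, Tendsto x atTop (𝓝 p) → Tendsto y atTop (𝓝 p) →
    ∃ z : ℕ → X, IsInfinitesimalMidpoint p x y z

/-- `X` is Busemann convex at the marked point `p`. -/
def BusemannConvexAt (p : X) : Prop :=
  MidpointConvexAt p ∧
    ∀ x0 x1 y m : ℕ → X, Tendsto x0 atTop (𝓝 p) → Tendsto x1 atTop (𝓝 p) →
      Tendsto y atTop (𝓝 p) → IsInfinitesimalMidpoint p x0 x1 m →
      Tendsto (fun n =>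
          max (dist (m n) (y n) - (dist (x0 n) (y n) + dist (x1 n) (y n)) / 2) 0
            / delta3 p (x0 n) (y n) (x1 n)) atTop (𝓝 (0 : ℝ))

end Defs

section MetricDefs

/-- `s` is a geodesic segment with endpoints `x` and `y`: a subset isometric to
the closed interval `[0, d(x,y)]`, the endpoints of the interval corresponding
to `x` and `y`. -/
def IsGeodesicSegment {Z : Type u} [MetricSpace Z] (s : Set Z) (x y : Z) : Prop :=
  ∃ f : ℝ → Z,
    (∀ a ∈ Set.Icc 0 (dist x y), ∀ b ∈ Set.Icc 0 (dist x y),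
      dist (f a) (f b) = |a - b|) ∧
    f '' Set.Icc 0 (dist x y) = s ∧ f 0 = x ∧ f (dist x y) = y

/-- A metric space is geodesic if any two points are the endpoints of some
geodesic segment. -/
def IsGeodesicSpace (Y : Type u) [MetricSpace Y] : Prop :=
  ∀ x y : Y, ∃ s : Set Y, IsGeodesicSegment s x y

/-- `m` is a midpoint of `x` and `y`. -/
def IsMidpointOf {Z : Type u} [MetricSpace Z] (m x y : Z) : Prop :=
  dist m x = dist x y / 2 ∧ dist m y = dist x y / 2

/-- An affinely parametrized geodesic `γ : [a,b] → Z`: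
`d(γ s, γ t) = λ |s - t|` for some constant `λ ≥ 0`. -/
def IsAffineGeodesic {Z : Type u} [MetricSpace Z] (γ : ℝ → Z) (a b : ℝ) : Prop :=
  ∃ lam : ℝ, 0 ≤ lam ∧ ∀ s ∈ Set.Icc a b, ∀ t ∈ Set.Icc a b,
    dist (γ s) (γ t) = lam * |s - t|

/-- Busemann convexity of a (geodesic) metric space: for any two affinely
parametrized geodesics the joint distance function is convex. -/
def BusemannConvex (Y : Type u) [MetricSpace Y] : Prop :=
  ∀ (a b a' b' : ℝ) (γ γ' : ℝ → Y), IsAffineGeodesic γ a b →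
    IsAffineGeodesic γ' a' b' →
    ConvexOn ℝ (Set.Icc a b ×ˢ Set.Icc a' b')
      (fun q : ℝ × ℝ => dist (γ q.1) (γ' q.2))

/-- A metric space is Ptolemaic if the Ptolemy inequality holds. -/
def Ptolemaic (Y : Type u) [MetricSpace Y] : Prop :=
  ∀ x y u v : Y, dist x y * dist u v ≤ dist x u * dist y v + dist x v * dist y u

end MetricDefs

section Helpers

theorem aux_zorn {A : Type*} (R : A → A → Prop) (F₀ : Set A)
    (h : ∀ x ∈ F₀, ∀ y ∈ F₀, R x y) :
    ∃ F : Set A, F₀ ⊆ F ∧ (∀ x ∈ F, ∀ y ∈ F, R x y) ∧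
      ∀ G : Set A, (∀ x ∈ G, ∀ y ∈ G, R x y) → F ⊆ G → G = F := by
  obtain ⟨F, hF0, hF⟩ := zorn_subset_nonempty {F : Set A | ∀ x ∈ F, ∀ y ∈ F, R x y} (by
    intro c hc hchain _
    refine ⟨⋃₀ c, ?_, fun s hs => Set.subset_sUnion_of_mem hs⟩
    rintro x ⟨s, hs, hx⟩ y ⟨t, ht, hy⟩
    rcases hchain.total hs ht with h | h
    · exact hc ht x (h hx) y hy
    · exact hc hs x hx y (h hy)) F₀ h
  refine ⟨F, hF0, hF.prop, fun G hG hFG => ?_⟩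
  exact Set.Subset.antisymm (hF.le_of_ge hG hFG) hFG

theorem aux_conv (a : ℕ → ℝ)
    (h : ∀ ε > 0, ∃ c : ℕ → ℝ, (∃ L, Tendsto c atTop (𝓝 L)) ∧ ∀ᶠ n in atTop, |a n - c n| < ε) :
    ∃ L, Tendsto a atTop (𝓝 L) := by
  apply cauchySeq_tendsto_of_complete
  rw [Metric.cauchySeq_iff']
  intro ε hε
  obtain ⟨c, ⟨L, hL⟩, hc⟩ := h (ε / 4) (by positivity)
  have h2 := Metric.tendsto_nhds.1 hL (ε / 4) (by positivity)
  obtain ⟨N, hN⟩ := eventually_atTop.1 (hc.and h2)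
  refine ⟨N, fun n hn => ?_⟩
  obtain ⟨h3, h4⟩ := hN n hn
  obtain ⟨h5, h6⟩ := hN N le_rfl
  rw [Real.dist_eq] at *
  rw [abs_lt] at *
  constructor <;> linarith

theorem aux_geodesic (Z : Type u) [MetricSpace Z] [CompleteSpace Z]
    (hm : ∀ x y : Z, ∃ m, dist x m = dist x y / 2 ∧ dist y m = dist x y / 2) :
    IsGeodesicSpace Z := by
  intro x y
  set L := dist x y with hL
  have hL0 : 0 ≤ L := dist_nonneg
  let R : ℝ × Z → ℝ × Z → Prop := fun P Q =>
    dist P.2 Q.2 = |P.1 - Q.1| ∧ P.1 ∈ Set.Icc 0 L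
  obtain ⟨S, hS0, hS, hmax⟩ := aux_zorn R {((0 : ℝ), x), (L, y)} (by
    rintro P (rfl | rfl) Q (rfl | rfl)
    · simp [R, hL0]
    · simp [R, hL0, abs_of_nonneg hL0, hL]
    · simp [R, hL0, abs_of_nonneg hL0, hL, dist_comm]
    · simp [R, hL0])
  have hx : ((0 : ℝ), x) ∈ S := hS0 (by simp)
  have hy : (L, y) ∈ S := hS0 (by simp)
  have hScl : IsClosed S := by
    have : closure S = S := by
      apply hmax _ _ subset_closure
      have hcl : IsClosed {q : (ℝ × Z) × (ℝ × Z) | R q.1 q.2} := by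
        apply IsClosed.inter
        · exact isClosed_eq (by fun_prop) (by fun_prop)
        · exact isClosed_Icc.preimage (by fun_prop : Continuous fun q : (ℝ × Z) × (ℝ × Z) => q.1.1)
      have h1 : closure (S ×ˢ S) ⊆ {q : (ℝ × Z) × (ℝ × Z) | R q.1 q.2} :=
        closure_minimal (fun q hq => hS _ hq.1 _ hq.2) hcl
      intro P hP Q hQ
      rw [closure_prod_eq] at h1
      exact h1 (Set.mk_mem_prod hP hQ)
    rw [← this]; exact isClosed_closure
  have hA : IsClosed (Prod.fst '' S) := by
    haveI : CompleteSpace S := hScl.completeSpace_coe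
    have hi : Isometry (fun P : S => P.1.1) := by
      apply Isometry.of_dist_eq
      intro P Q
      have := (hS _ P.2 _ Q.2).1
      rw [Subtype.dist_eq, Prod.dist_eq, this, Real.dist_eq, max_self]
    have := hi.isClosedEmbedding.isClosed_range
    convert this using 1
    ext t; simp
  have hfull : ∀ t ∈ Set.Icc 0 L, ∃ z, (t, z) ∈ S := by
    intro t ht
    by_contra hcon
    have htA : t ∉ Prod.fst '' S := by
      rintro ⟨⟨t', z⟩, h1, h2⟩
      simp only at h2
      subst h2
      exact hcon ⟨z, h1⟩
    obtain ⟨a, ⟨haA, ha⟩, hag⟩ := (isCompact_Icc.inter_left hA (t := Set.Icc 0 t)).exists_isGreatest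
      ⟨0, ⟨_, hx, rfl⟩, le_rfl, ht.1⟩
    obtain ⟨b, ⟨hbA, hb⟩, hbg⟩ := (isCompact_Icc.inter_left hA (t := Set.Icc t L)).exists_isLeast
      ⟨L, ⟨_, hy, rfl⟩, ht.2, le_rfl⟩
    have hat : a < t := lt_of_le_of_ne ha.2 (fun h => htA (h ▸ haA))
    have htb : t < b := lt_of_le_of_ne hb.1 (fun h => htA (h ▸ hbA))
    obtain ⟨⟨a', u⟩, hu, rfl⟩ := haA
    obtain ⟨⟨b', v⟩, hv, rfl⟩ := hbA
    simp only at *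
    obtain ⟨m, hm1, hm2⟩ := hm u v
    have huv := (hS _ hu _ hv).1
    simp only at huv
    rw [abs_sub_comm, abs_of_pos (by linarith)] at huv
    have key : ∀ P ∈ S, dist P.2 m = |P.1 - (a' + b') / 2| := by
      rintro ⟨c, w⟩ hw
      have h1 := (hS _ hw _ hu).1
      have h2 := (hS _ hw _ hv).1
      have h3 := (hS _ hw _ hw).2
      simp only at h1 h2 h3 ⊢
      have t1 := dist_triangle w u m
      have t2 := dist_triangle w v m
      have t3 := dist_triangle w m v
      have t4 := dist_triangle w m u
      rw [dist_comm m v] at t3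
      rw [dist_comm m u] at t4
      rcases le_total c t with hct | hct
      · have hca : c ≤ a' := hag ⟨⟨_, hw, rfl⟩, h3.1, hct⟩
        rw [abs_of_nonpos (by linarith)] at h1 h2 ⊢
        linarith
      · have hca : b' ≤ c := hbg ⟨⟨_, hw, rfl⟩, hct, h3.2⟩
        rw [abs_of_nonneg (by linarith)] at h1 h2 ⊢
        linarith
    have hin : (a' + b') / 2 ∈ Set.Icc 0 L := ⟨by linarith [ha.1, hb.2, ht.1], by linarith [ha.2, hb.2]⟩
    have hG := hmax (insert ((a' + b') / 2, m) S) (by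
      rintro P (rfl | hP) Q (rfl | hQ)
      · exact ⟨by simp, hin⟩
      · refine ⟨?_, hin⟩
        have := key Q hQ
        rw [dist_comm, abs_sub_comm]; exact this
      · exact ⟨key P hP, (hS _ hP _ hP).2⟩
      · exact hS _ hP _ hQ) (Set.subset_insert _ _)
    have hmS : ((a' + b') / 2, m) ∈ S := hG ▸ Set.mem_insert _ _
    rcases le_total ((a' + b') / 2) t with hct | hct
    · have : (a' + b') / 2 ≤ a' := hag ⟨⟨_, hmS, rfl⟩, hin.1, hct⟩
      linarith
    · have : b' ≤ (a' + b') / 2 := hbg ⟨⟨_, hmS, rfl⟩, hct, hin.2⟩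
      linarith
  have hex : ∀ t : ℝ, ∃ z, t ∈ Set.Icc 0 L → (t, z) ∈ S := by
    intro t
    by_cases ht : t ∈ Set.Icc 0 L
    · obtain ⟨z, hz⟩ := hfull t ht
      exact ⟨z, fun _ => hz⟩
    · exact ⟨x, fun h => absurd h ht⟩
  choose f hf using hex
  refine ⟨_, f, fun a ha b hb => (hS _ (hf a ha) _ (hf b hb)).1, rfl, ?_, ?_⟩
  · have := (hS _ (hf 0 ⟨le_rfl, hL0⟩) _ hx).1
    simpa using this
  · have := (hS _ (hf L ⟨hL0, le_rfl⟩) _ hy).1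
    simpa using this

variable {X : Type u} [MetricSpace X]

theorem aux_close {r : ℕ → ℝ} (hr : ∀ n, 0 < r n) (x y w : ℕ → X) (n : ℕ) :
    |dist (y n) (w n) / r n - dist (x n) (w n) / r n| ≤ dist (x n) (y n) / r n := by
  rw [← sub_div, abs_div, abs_of_pos (hr n)]
  have := abs_dist_sub_le (y n) (x n) (w n)
  rw [dist_comm (y n) (x n)] at this
  exact div_le_div_of_nonneg_right this (hr n).le

theorem aux_self {r : ℕ → ℝ} (x : ℕ → X) : MutuallyStable r x x := ⟨0, by simp⟩

theorem aux_symm {r : ℕ → ℝ} {x y : ℕ → X} (h : MutuallyStable r x y) : MutuallyStable r y x := by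
  obtain ⟨L, hL⟩ := h
  exact ⟨L, by simpa only [dist_comm] using hL⟩

theorem aux_insert {r : ℕ → ℝ} {F : Set (ℕ → X)} (hF : SelfStable r F) (y : ℕ → X)
    (hy : ∀ w ∈ F, MutuallyStable r y w) : SelfStable r (insert y F) := by
  rintro a (rfl | ha) b (rfl | hb)
  · exact aux_self _
  · exact hy b hb
  · exact aux_symm (hy a ha)
  · exact hF a ha b hb

/-- completeness of pretangent spaces -/
theorem aux_complete {p : X} {r : ℕ → ℝ} {F : Set (ℕ → X)} {Ω : Type u} [MetricSpace Ω]
    {π : (ℕ → X) → Ω} (h : IsPretangentSpace p r F π) : CompleteSpace Ω := by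
  obtain ⟨⟨hr, hr0⟩, ⟨hF, hp, hmax⟩, hsurj, hlim⟩ := h
  have hB : Tendsto (fun n : ℕ => (1 / 2 : ℝ) ^ n) atTop (𝓝 0) :=
    tendsto_pow_atTop_nhds_zero_of_lt_one (by norm_num) (by norm_num)
  refine Metric.complete_of_convergent_controlled_sequences (fun n => (1 / 2 : ℝ) ^ n)
    (fun n => by positivity) ?_
  intro u hu
  choose x hxF hx using fun k => hsurj (u k)
  have h1 : ∀ k, ∃ N : ℕ, ∀ n ≥ N, ∀ i ≤ k, dist (x i n) (x k n) / r n < (1 / 2 : ℝ) ^ i := by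
    intro k
    rw [← eventually_atTop]
    have : ∀ i ∈ Set.Iic k, ∀ᶠ n in atTop, dist (x i n) (x k n) / r n < (1 / 2 : ℝ) ^ i := by
      intro i hi
      have := hlim _ (hxF i) _ (hxF k)
      rw [hx, hx] at this
      exact this.eventually_lt_const (hu i i k le_rfl hi)
    exact ((Set.finite_Iic k).eventually_all).2 this
  choose N hN using h1
  let κ : ℕ → ℕ := fun n => Nat.findGreatest (fun k => N k ≤ n) n
  let y : ℕ → X := fun n => x (κ n) n
  have hy : ∀ i, ∀ᶠ n in atTop, dist (x i n) (y n) / r n < (1 / 2 : ℝ) ^ i := by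
    intro i
    filter_upwards [eventually_ge_atTop (max i (N i))] with n hn
    have hi : i ≤ n := le_trans (le_max_left _ _) hn
    have hNi : N i ≤ n := le_trans (le_max_right _ _) hn
    have ha : i ≤ κ n := Nat.le_findGreatest hi hNi
    have hb : N (κ n) ≤ n := Nat.findGreatest_spec (P := fun k => N k ≤ n) hi hNi
    exact hN (κ n) n hb i ha
  have hst : ∀ w ∈ F, MutuallyStable r y w := by
    intro w hw
    apply aux_conv
    intro ε hε
    obtain ⟨i, hi⟩ := (hB.eventually_lt_const hε).exists
    refine ⟨fun n => dist (x i n) (w n) / r n, hF _ (hxF i) _ hw, ?_⟩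
    filter_upwards [hy i] with n hn
    exact (aux_close hr _ _ _ n).trans_lt (hn.trans hi)
  have hyF : y ∈ F := by
    have := hmax _ (aux_insert hF y hst) (Set.subset_insert _ _)
    rw [← this]; exact Set.mem_insert _ _
  refine ⟨π y, ?_⟩
  rw [tendsto_iff_dist_tendsto_zero]
  refine squeeze_zero (fun _ => dist_nonneg) (fun i => ?_) hB
  have := hlim _ (hxF i) _ hyF
  rw [hx] at this
  exact le_of_tendsto this ((hy i).mono fun n hn => hn.le)

theorem aux_midQuot (p w x y z : X) (hw : w = x ∨ w = y) (ε : ℝ)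
    (h : midQuot p w x y z < (ε : EReal)) :
    |dist w z - dist x y / 2| ≤ ε * (dist x p + dist y p) := by
  unfold midQuot at h
  split_ifs at h with h1 h2
  · obtain ⟨rfl, rfl⟩ := h1
    subst h2
    rcases hw with rfl | rfl <;> simp
  · exact absurd h (by simp)
  · have h' : |dist w z - dist x y / 2| / max (dist x p) (dist y p) < ε := by exact_mod_cast h
    have hpos : 0 < max (dist x p) (dist y p) := by
      by_contra hc
      push Not at hc
      have ha := (max_le_iff.1 hc)
      exact h1 ⟨dist_le_zero.1 ha.1, dist_le_zero.1 ha.2⟩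
    have hε : 0 ≤ ε := le_trans (by positivity) h'.le
    rw [div_lt_iff₀ hpos] at h'
    refine h'.le.trans (mul_le_mul_of_nonneg_left ?_ hε)
    exact max_le (by linarith [dist_nonneg (x := y) (y := p)]) (by linarith [dist_nonneg (x := x) (y := p)])

theorem aux_midlim {p : X} {r : ℕ → ℝ} (hr : ∀ n, 0 < r n) (w x y z : ℕ → X)
    (hw : ∀ n, w n = x n ∨ w n = y n) {L a b : ℝ}
    (hL : Tendsto (fun n => dist (x n) (y n) / r n) atTop (𝓝 L))
    (ha : Tendsto (fun n => dist (x n) p / r n) atTop (𝓝 a))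
    (hb : Tendsto (fun n => dist (y n) p / r n) atTop (𝓝 b))
    (h : Tendsto (fun n => midQuot p (w n) (x n) (y n) (z n)) atTop (𝓝 (0 : EReal))) :
    Tendsto (fun n => dist (w n) (z n) / r n) atTop (𝓝 (L / 2)) := by
  have hab : 0 ≤ a + b := by
    have h1 : 0 ≤ a := ge_of_tendsto' ha fun n => div_nonneg dist_nonneg (hr n).le
    have h2 : 0 ≤ b := ge_of_tendsto' hb fun n => div_nonneg dist_nonneg (hr n).le
    linarith
  have hz : Tendsto (fun n => dist (w n) (z n) / r n - dist (x n) (y n) / r n / 2) atTop (𝓝 0) := by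
    rw [Metric.tendsto_nhds]
    intro ε hε
    have hδ : 0 < ε / (a + b + 2) := by positivity
    have e1 := h.eventually_lt_const (u := ((ε / (a + b + 2) : ℝ) : EReal)) (by exact_mod_cast hδ)
    have e2 := (ha.add hb).eventually_lt_const (u := a + b + 1) (by linarith)
    filter_upwards [e1, e2] with n h1 h2
    have h3 := aux_midQuot p _ _ _ _ (hw n) _ h1
    have hrn := hr n
    rw [Real.dist_eq, sub_zero, div_right_comm, ← sub_div, abs_div, abs_of_pos hrn]
    calc _ ≤ ε / (a + b + 2) * (dist (x n) p + dist (y n) p) / r n :=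
          div_le_div_of_nonneg_right h3 hrn.le
      _ = ε / (a + b + 2) * (dist (x n) p / r n + dist (y n) p / r n) := by ring
      _ < ε / (a + b + 2) * (a + b + 2) := mul_lt_mul_of_pos_left (by linarith) hδ
      _ = ε := by field_simp
  have := hz.add (hL.div_const 2)
  simpa using this

theorem aux_toP {p : X} {r : ℕ → ℝ} (hr : IsNormalizingSeq r) (x : ℕ → X) {a : ℝ}
    (ha : Tendsto (fun n => dist (x n) p / r n) atTop (𝓝 a)) : Tendsto x atTop (𝓝 p) := by
  rw [tendsto_iff_dist_tendsto_zero]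
  have := ha.mul hr.2
  rw [mul_zero] at this
  refine this.congr fun n => ?_
  have := (hr.1 n).ne'
  field_simp

theorem aux_A1bound (p w x y z : X) : |A1 p w x y z| ≤ 16 := by
  unfold A1
  split_ifs with h
  · simp
  · have h1 : dist w p ≤ delta4 p w x y z := by simp [delta4]
    have h2 : dist x p ≤ delta4 p w x y z := by simp [delta4]
    have h3 : dist y p ≤ delta4 p w x y z := by simp [delta4]
    have h4 : dist z p ≤ delta4 p w x y z := by simp [delta4]
    have hpos : 0 < delta4 p w x y z := by
      by_contra hc
      push Not at hc
      exact h ⟨dist_le_zero.1 (h1.trans hc), dist_le_zero.1 (h2.trans hc),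
        dist_le_zero.1 (h3.trans hc), dist_le_zero.1 (h4.trans hc)⟩
    have key : ∀ a b : X, dist a p ≤ delta4 p w x y z → dist b p ≤ delta4 p w x y z →
        dist a b ^ 2 ≤ 4 * delta4 p w x y z ^ 2 := by
      intro a b ha hb
      have := dist_triangle_right a b p
      have h0 : 0 ≤ dist a b := dist_nonneg
      nlinarith
    have k1 := key w x h1 h2
    have k2 := key x y h2 h3
    have k3 := key y z h3 h4
    have k4 := key z w h4 h1
    have k5 := key w y h1 h3
    have k6 := key x z h2 h4
    rw [abs_div, abs_of_pos (pow_pos hpos 2), div_le_iff₀ (pow_pos hpos 2), abs_le]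
    constructor <;> nlinarith [sq_nonneg (dist w x), sq_nonneg (dist x y), sq_nonneg (dist y z),
      sq_nonneg (dist z w), sq_nonneg (dist w y), sq_nonneg (dist x z)]

theorem aux_A1ge (p w x y z : X) (ε : ℝ) (hε : 0 < ε) (h : -ε < A1 p w x y z) :
    -(ε * (dist w p + dist x p + dist y p + dist z p) ^ 2) ≤
      dist w x ^ 2 + dist x y ^ 2 + dist y z ^ 2 + dist z w ^ 2
          - dist w y ^ 2 - dist x z ^ 2 := by
  unfold A1 at h
  have g1 : 0 ≤ dist w p := dist_nonneg
  have g2 : 0 ≤ dist x p := dist_nonneg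
  have g3 : 0 ≤ dist y p := dist_nonneg
  have g4 : 0 ≤ dist z p := dist_nonneg
  split_ifs at h with hh
  · obtain ⟨rfl, rfl, rfl, rfl⟩ := hh
    simp
  · have h1 : dist w p ≤ delta4 p w x y z := by simp [delta4]
    have h2 : dist x p ≤ delta4 p w x y z := by simp [delta4]
    have h3 : dist y p ≤ delta4 p w x y z := by simp [delta4]
    have h4 : dist z p ≤ delta4 p w x y z := by simp [delta4]
    have hpos : 0 < delta4 p w x y z := by
      by_contra hc
      push Not at hc
      exact hh ⟨dist_le_zero.1 (h1.trans hc), dist_le_zero.1 (h2.trans hc),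
        dist_le_zero.1 (h3.trans hc), dist_le_zero.1 (h4.trans hc)⟩
    have hle : delta4 p w x y z ≤ dist w p + dist x p + dist y p + dist z p := by
      unfold delta4
      refine max_le ?_ (max_le ?_ (max_le ?_ ?_)) <;> linarith
    rw [lt_div_iff₀ (pow_pos hpos 2)] at h
    have := mul_le_mul_of_nonneg_left (pow_le_pow_left₀ hpos.le hle 2) hε.le
    linarith

/-- the quadrilateral inequality -/
theorem aux_quad {p : X}
    (hA1 : 0 ≤ liminf (fun q : X × X × X × X => A1 p q.1 q.2.1 q.2.2.1 q.2.2.2)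
        (𝓝 (p, p, p, p))) {r : ℕ → ℝ} {F : Set (ℕ → X)} {Ω : Type u} [MetricSpace Ω]
    {π : (ℕ → X) → Ω} (h : IsPretangentSpace p r F π) (α β γ η : Ω) :
    dist α γ ^ 2 + dist β η ^ 2 ≤
          dist α β ^ 2 + dist β γ ^ 2 + dist γ η ^ 2 + dist η α ^ 2 := by
  obtain ⟨hr, ⟨hF, hp, hmax⟩, hsurj, hlim⟩ := h
  obtain ⟨w, hw, rfl⟩ := hsurj α
  obtain ⟨x, hx, rfl⟩ := hsurj β
  obtain ⟨y, hy, rfl⟩ := hsurj γ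
  obtain ⟨z, hz, rfl⟩ := hsurj η
  have hwp := hlim w hw _ hp
  have hxp := hlim x hx _ hp
  have hyp := hlim y hy _ hp
  have hzp := hlim z hz _ hp
  have htend : Tendsto (fun n => (w n, x n, y n, z n)) atTop (𝓝 (p, p, p, p)) :=
    (aux_toP hr w hwp).prodMk_nhds ((aux_toP hr x hxp).prodMk_nhds
      ((aux_toP hr y hyp).prodMk_nhds (aux_toP hr z hzp)))
  have hS := (((hwp.add hxp).add hyp).add hzp).pow 2
  set C := (dist (π w) (π fun _ => p) + dist (π x) (π fun _ => p) + dist (π y) (π fun _ => p)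
    + dist (π z) (π fun _ => p)) ^ 2 with hC
  have hC0 : 0 ≤ C := sq_nonneg _
  have hD := (((((hlim w hw x hx).pow 2).add ((hlim x hx y hy).pow 2)).add
    ((hlim y hy z hz).pow 2)).add ((hlim z hz w hw).pow 2)).sub ((hlim w hw y hy).pow 2)
    |>.sub ((hlim x hx z hz).pow 2)
  have key : ∀ ε > 0, -(ε * C) ≤ dist (π w) (π x) ^ 2 + dist (π x) (π y) ^ 2 +
      dist (π y) (π z) ^ 2 + dist (π z) (π w) ^ 2 - dist (π w) (π y) ^ 2 - dist (π x) (π z) ^ 2 := by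
    intro ε hε
    have hbdd : IsBoundedUnder (· ≥ ·) (𝓝 (p, p, p, p))
        (fun q : X × X × X × X => A1 p q.1 q.2.1 q.2.2.1 q.2.2.2) :=
      isBoundedUnder_of ⟨-16, fun q => (abs_le.1 (aux_A1bound p _ _ _ _)).1⟩
    have hev := eventually_lt_of_lt_liminf (b := -ε) (lt_of_lt_of_le (by linarith) hA1) hbdd
    refine le_of_tendsto_of_tendsto (hS.const_mul ε).neg hD ?_
    filter_upwards [htend.eventually hev] with n hn
    have := aux_A1ge p _ _ _ _ ε hε hn
    have hrn := hr.1 n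
    have h2 := div_le_div_of_nonneg_right this (sq_nonneg (r n))
    have e1 : -(ε * (dist (w n) p + dist (x n) p + dist (y n) p + dist (z n) p) ^ 2) / r n ^ 2 =
      -(ε * (dist (w n) p / r n + dist (x n) p / r n + dist (y n) p / r n + dist (z n) p / r n) ^ 2) := by
      field_simp
    rw [e1] at h2
    refine h2.trans (le_of_eq ?_)
    field_simp
  by_contra hcon
  push Not at hcon
  set D := dist (π w) (π x) ^ 2 + dist (π x) (π y) ^ 2 +
      dist (π y) (π z) ^ 2 + dist (π z) (π w) ^ 2 - dist (π w) (π y) ^ 2 - dist (π x) (π z) ^ 2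
    with hDdef
  have hDneg : D < 0 := by linarith
  have := key (-D / (C + 1)) (div_pos (by linarith) (by linarith))
  have h3 : -D / (C + 1) * C < -D := by
    rw [div_mul_eq_mul_div, div_lt_iff₀ (by linarith)]
    nlinarith
  linarith

/-- midpoints -/
theorem aux_mid {p : X} (hmid : MidpointConvexAt p) {r : ℕ → ℝ} {F : Set (ℕ → X)} {Ω : Type u}
    [MetricSpace Ω] {π : (ℕ → X) → Ω} (h : IsPretangentSpace p r F π)
    (ht : IsTangentFamily p r F) [TopologicalSpace.SeparableSpace Ω] (α β : Ω) :
    ∃ m, dist α m = dist α β / 2 ∧ dist β m = dist α β / 2 := by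
  obtain ⟨hr, ⟨hF, hp, hmax⟩, hsurj, hlim⟩ := h
  obtain ⟨x, hx, rfl⟩ := hsurj α
  obtain ⟨y, hy, rfl⟩ := hsurj β
  have hxp := hlim x hx _ hp
  have hyp := hlim y hy _ hp
  obtain ⟨z, hz1, hz2⟩ := hmid x y (aux_toP hr x hxp) (aux_toP hr y hyp)
  have hxz := aux_midlim hr.1 x x y z (fun _ => Or.inl rfl) (hlim x hx y hy) hxp hyp hz1
  have hyz := aux_midlim hr.1 y x y z (fun _ => Or.inr rfl) (hlim x hx y hy) hxp hyp hz2
  haveI : Nonempty Ω := ⟨π x⟩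
  choose s hsF hs using fun i => hsurj (TopologicalSpace.denseSeq Ω i)
  have hb : ∀ i, ∃ C, ∀ n, dist (z n) (s i n) / r n ≤ C := by
    intro i
    obtain ⟨C1, h1⟩ := hxz.bddAbove_range
    obtain ⟨C2, h2⟩ := (hlim x hx _ (hsF i)).bddAbove_range
    refine ⟨C1 + C2, fun n => ?_⟩
    have g1 := h1 ⟨n, rfl⟩
    have g2 := h2 ⟨n, rfl⟩
    simp only at g1 g2
    have := div_le_div_of_nonneg_right (dist_triangle_left (z n) (s i n) (x n)) (hr.1 n).le
    rw [add_div] at this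
    linarith
  choose C hC using hb
  have hcomp : IsCompact (Set.pi Set.univ fun i => Set.Icc (0 : ℝ) (C i)) :=
    isCompact_univ_pi fun i => isCompact_Icc
  obtain ⟨l, -, φ, hφ, hl⟩ := hcomp.tendsto_subseq
    (x := fun n i => dist (z n) (s i n) / r n)
    (fun n i _ => ⟨div_nonneg dist_nonneg (hr.1 n).le, hC i n⟩)
  rw [tendsto_pi_nhds] at hl
  have hsub : SelfStable (r ∘ φ) ((fun x => x ∘ φ) '' F) := by
    rintro _ ⟨a, ha, rfl⟩ _ ⟨b, hb, rfl⟩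
    exact ⟨_, (hlim a ha b hb).comp hφ.tendsto_atTop⟩
  have hzst : ∀ w ∈ (fun x => x ∘ φ) '' F, MutuallyStable (r ∘ φ) (z ∘ φ) w := by
    rintro _ ⟨a, ha, rfl⟩
    apply aux_conv
    intro ε hε
    obtain ⟨i, hi⟩ := (TopologicalSpace.denseRange_denseSeq Ω).exists_dist_lt (π a) hε
    refine ⟨fun n => dist (z (φ n)) (s i (φ n)) / r (φ n), ⟨_, hl i⟩, ?_⟩
    have h1 := (hlim _ (hsF i) _ ha).comp hφ.tendsto_atTop
    rw [hs, dist_comm] at h1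
    filter_upwards [h1.eventually_lt_const hi] with n hn
    have := aux_close hr.1 (s i) a z (φ n)
    rw [dist_comm (a _), dist_comm (s i _) (z _)] at this
    exact this.trans_lt hn
  obtain ⟨F', hsubF, hF', hmaxF'⟩ := aux_zorn (MutuallyStable (r ∘ φ)) _ (aux_insert hsub _ hzst)
  have hin : ∀ x ∈ F, x ∘ φ ∈ F' := fun x hx => hsubF (Or.inr ⟨x, hx, rfl⟩)
  obtain ⟨m, hmF, hm⟩ := ht φ hφ F' ⟨hF', hin _ hp, hmaxF'⟩ hin (z ∘ φ) (hsubF (Or.inl rfl))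
  have fin : ∀ w ∈ F, ∀ L, Tendsto (fun n => dist (w n) (z n) / r n) atTop (𝓝 L) →
      dist (π w) (π m) = L := by
    intro w hw L hL
    have h1 := (hlim w hw m hmF).comp hφ.tendsto_atTop
    have h2 := hL.comp hφ.tendsto_atTop
    have h3 := h1.sub h2
    have h4 : Tendsto ((fun n => dist (w n) (m n) / r n) ∘ φ - (fun n => dist (w n) (z n) / r n) ∘ φ)
        atTop (𝓝 0) := by
      refine squeeze_zero_norm (fun k => ?_) hm
      have := aux_close hr.1 m z w (φ k)
      rw [abs_sub_comm, dist_comm (m _) (w _), dist_comm (z _) (w _)] at this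
      exact this
    have := tendsto_nhds_unique h3 h4
    linarith
  exact ⟨π m, fin x hx _ hxz, fin y hy _ hyz⟩

end Helpers

/-- if `X` is midpoint convex at `p` and
`liminf_{w,x,y,z → p} A₁ ≥ 0`, then every separable tangent space is a geodesic
space satisfying the quadrilateral inequality (hence CAT(0)). -/
theorem separable_tangent_space_CAT0
    {X : Type u} [MetricSpace X] (p : X)
    (hmid : MidpointConvexAt p)
    (hA1 : 0 ≤ liminf (fun q : X × X × X × X => A1 p q.1 q.2.1 q.2.2.1 q.2.2.2)
        (𝓝 (p, p, p, p))) :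
    ∀ (r : ℕ → ℝ) (F : Set (ℕ → X)) (Ω : Type u) [MetricSpace Ω]
      (π : (ℕ → X) → Ω), IsPretangentSpace p r F π → IsTangentFamily p r F →
      TopologicalSpace.SeparableSpace Ω →
      IsGeodesicSpace Ω ∧
        ∀ α β γ η : Ω, dist α γ ^ 2 + dist β η ^ 2 ≤
          dist α β ^ 2 + dist β γ ^ 2 + dist γ η ^ 2 + dist η α ^ 2 := by
  intro r F Ω _ π h ht hsep
  haveI := aux_complete h
  exact ⟨aux_geodesic Ω (fun α β => aux_mid hmid h ht α β), fun α β γ η => aux_quad hA1 h α β γ η⟩
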